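/- For all real numbers p and R with 0 < p < 1/2 and 0 < R, and every positive integer L, if R < 1 − (1 + 1/L)·(H(p) + p·log₂ 3), then there exists a natural number N such that for every n ≥ N there is a subspace S of (ZMod 2)^n × (ZMod 2)^n of dimension n − ⌊R·n⌋ satisfying ω(x, y) = 0 for all x, y ∈ S, and such that there do not exist L + 1 linearly independent vectors E₀, E₁, …, E_L in (ZMod 2)^n × (ZMod 2)^n, each of weight at most ⌊p·n⌋ and none lying in S, with ω(Eᵢ + Eⱼ, s) = 0 for all 0 ≤ i, j ≤ L and all s ∈ S. -/

import Mathlib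

/-- The binary symplectic form on `(ZMod 2)^n × (ZMod 2)^n`:
`ω((u,v),(u',v')) = u·v' + u'·v` (mod 2). -/
def symp {n : ℕ} (x y : (Fin n → ZMod 2) × (Fin n → ZMod 2)) : ZMod 2 :=
  (∑ i, x.1 i * y.2 i) + (∑ i, y.1 i * x.2 i)

/-- The weight of `(u,v)`: the number of positions `i` with `(u i, v i) ≠ (0,0)`. -/
def wt {n : ℕ} (x : (Fin n → ZMod 2) × (Fin n → ZMod 2)) : ℕ :=
  (Finset.univ.filter (fun i : Fin n => ¬(x.1 i = 0 ∧ x.2 i = 0))).card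

/-- Binary entropy. -/
noncomputable def H (p : ℝ) : ℝ :=
  -p * Real.logb 2 p - (1 - p) * Real.logb 2 (1 - p)

section Isotropic

open Module Finset

variable {V : Type*} [AddCommGroup V] [Module (ZMod 2) V]

variable (B : LinearMap.BilinForm (ZMod 2) V)

open Classical in
/-- Weight of `W` in the potential for extending the isotropic space `S` to dimension `m`: up to a
normalisation, an upper estimate for the probability that a random extension of `S` is orthogonal
to `W`. -/
noncomputable def isotropicWeight (m : ℕ) (S W : Submodule (ZMod 2) V) : ℝ :=
  if W ≤ B.orthogonal S then
    2 ^ (finrank (ZMod 2) ↥(S ⊓ W) * (m - finrank (ZMod 2) S)) else 0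

variable {B}

lemma isotropicWeight_nonneg (m : ℕ) (S W : Submodule (ZMod 2) V) :
    0 ≤ isotropicWeight B m S W := by
  unfold isotropicWeight
  split_ifs <;> positivity

variable [Fintype V]

lemma card_filter_mem_submodule (U : Submodule (ZMod 2) V)
    [DecidablePred (· ∈ U)] :
    ((univ.filter (· ∈ U)).card : ℝ) = 2 ^ finrank (ZMod 2) U := by
  have h := Module.card_eq_pow_finrank (K := ZMod 2) (V := U)
  rw [ZMod.card, Fintype.card_subtype] at h
  exact_mod_cast h

lemma finrank_sup_span_inf_le (S W : Submodule (ZMod 2) V) (s : V) :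
    finrank (ZMod 2) ↥((S ⊔ Submodule.span (ZMod 2) {s}) ⊓ W) ≤
      finrank (ZMod 2) ↥(S ⊓ W) + 1 := by
  by_cases hs : s ∈ S
  · rw [sup_eq_left.2 (by simpa using hs)]
    exact Nat.le_succ _
  · have h₁ := Submodule.finrank_sup_add_finrank_inf_eq S W
    have h₂ := Submodule.finrank_sup_add_finrank_inf_eq (S ⊔ Submodule.span (ZMod 2) {s}) W
    rw [Submodule.finrank_sup_span_singleton hs] at h₂
    have h₃ : finrank (ZMod 2) ↥(S ⊔ W) ≤
        finrank (ZMod 2) ↥(S ⊔ Submodule.span (ZMod 2) {s} ⊔ W) :=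
      Submodule.finrank_mono (sup_le_sup_right le_sup_left _)
    omega

lemma finrank_sup_span_inf_eq (S W : Submodule (ZMod 2) V) {s : V} (hs : s ∉ S ⊔ W) :
    finrank (ZMod 2) ↥((S ⊔ Submodule.span (ZMod 2) {s}) ⊓ W) =
      finrank (ZMod 2) ↥(S ⊓ W) := by
  have h₁ := Submodule.finrank_sup_add_finrank_inf_eq S W
  have h₂ := Submodule.finrank_sup_add_finrank_inf_eq (S ⊔ Submodule.span (ZMod 2) {s}) W
  rw [Submodule.finrank_sup_span_singleton fun h => hs (Submodule.mem_sup_left h), sup_right_comm,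
    Submodule.finrank_sup_span_singleton hs] at h₂
  omega

open Classical in
lemma sum_isotropicWeight_sup_span_le (hB : B.Nondegenerate) (hB' : B.IsRefl) {n m L : ℕ}
    (hV : finrank (ZMod 2) V = 2 * n) {S W : Submodule (ZMod 2) V}
    (hS : finrank (ZMod 2) S < m) (hW : finrank (ZMod 2) W = L) :
    ∑ s with s ∈ B.orthogonal S ∧ s ∉ S,
        isotropicWeight B m (S ⊔ Submodule.span (ZMod 2) {s}) W ≤
      ((2 : ℝ) ^ (2 * n - finrank (ZMod 2) S) / 2 ^ L + 2 ^ (L + m)) * isotropicWeight B m S W := by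
  by_cases hWS : W ≤ B.orthogonal S
  swap
  · rw [sum_eq_zero]
    · exact mul_nonneg (by positivity) (isotropicWeight_nonneg _ _ _)
    · intro s _
      exact if_neg fun h => hWS (h.trans (B.orthogonal_le le_sup_left))
  obtain ⟨d, hd⟩ := Nat.exists_eq_add_of_lt hS
  set j := finrank (ZMod 2) S with hj
  set t := finrank (ZMod 2) ↥(S ⊓ W) with ht
  have hdim := Submodule.finrank_sup_add_finrank_inf_eq S W
  rw [hW, ← ht, ← hj] at hdim
  have hle := Submodule.finrank_le (S ⊔ W)
  have hle' := Submodule.finrank_le S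
  have hpoint : ∀ s ∈ univ.filter (fun s => s ∈ B.orthogonal S ∧ s ∉ S),
      isotropicWeight B m (S ⊔ Submodule.span (ZMod 2) {s}) W ≤
        (if s ∈ B.orthogonal (S ⊔ W) then (2 : ℝ) ^ (t * d) else 0) +
          (if s ∈ S ⊔ W then (2 : ℝ) ^ ((t + 1) * d) else 0) := by
    intro s hs
    obtain ⟨hsS, hsS'⟩ := (mem_filter.1 hs).2
    by_cases hsW : W ≤ B.orthogonal (S ⊔ Submodule.span (ZMod 2) {s})
    swap
    · rw [isotropicWeight, if_neg hsW]
      positivity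
    rw [isotropicWeight, if_pos hsW, Submodule.finrank_sup_span_singleton hsS',
      show m - (finrank (ZMod 2) S + 1) = d by omega]
    by_cases hs' : s ∈ S ⊔ W
    · rw [if_pos hs']
      refine le_add_of_nonneg_of_le (by positivity) ?_
      exact pow_le_pow_right₀ one_le_two
        (Nat.mul_le_mul_right _ (finrank_sup_span_inf_le S W s))
    · have hmem : s ∈ B.orthogonal (S ⊔ W) := by
        intro x hx
        obtain ⟨a, ha, b, hb, rfl⟩ := Submodule.mem_sup.1 hx
        have h₁ : B a s = 0 := hsS a ha
        have h₂ : B b s = 0 := hB' _ _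
          (hsW hb s (Submodule.mem_sup_right (Submodule.mem_span_singleton_self s)))
        change B (a + b) s = 0
        rw [map_add, LinearMap.add_apply, h₁, h₂, add_zero]
      rw [if_pos hmem, if_neg hs', finrank_sup_span_inf_eq S W hs', add_zero]
  refine (sum_le_sum hpoint).trans ((sum_le_sum_of_subset_of_nonneg (subset_univ _)
    fun s _ _ => by positivity).trans ?_)
  rw [sum_add_distrib, ← sum_filter, ← sum_filter, sum_const, sum_const, nsmul_eq_mul, nsmul_eq_mul,
    card_filter_mem_submodule, card_filter_mem_submodule,
    LinearMap.BilinForm.finrank_orthogonal hB, hV, isotropicWeight, if_pos hWS,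
    add_mul (_ / _)]
  refine add_le_add (le_of_eq ?_) ?_
  · rw [div_mul_eq_mul_div, eq_div_iff (by positivity), ← pow_add, ← pow_add, ← pow_add]
    congr 1
    rw [← ht, ← hj, show m - j = d + 1 by omega, mul_add]
    omega
  · rw [← pow_add, ← pow_add]
    refine pow_le_pow_right₀ one_le_two ?_
    rw [← ht, ← hj, show m - j = d + 1 by omega, mul_add, add_mul]
    omega

open Classical in
lemma exists_isotropic_sup_span (hB : B.Nondegenerate) (hB' : B.IsAlt) {n m L : ℕ}
    (hV : finrank (ZMod 2) V = 2 * n) {ι : Type*} (I : Finset ι) (W : ι → Submodule (ZMod 2) V)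
    (hW : ∀ i ∈ I, finrank (ZMod 2) (W i) = L) {r : ℝ}
    {S : Submodule (ZMod 2) V} (hS : finrank (ZMod 2) S < m) (hSn : finrank (ZMod 2) S < n)
    (hiso : S ≤ B.orthogonal S)
    (hr : (2 : ℝ) ^ (2 * n - finrank (ZMod 2) S) / 2 ^ L + 2 ^ (L + m) ≤
      r * (2 ^ (2 * n - finrank (ZMod 2) S) - 2 ^ finrank (ZMod 2) S)) :
    ∃ T : Submodule (ZMod 2) V, finrank (ZMod 2) T = finrank (ZMod 2) S + 1 ∧
      T ≤ B.orthogonal T ∧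
      ∑ i ∈ I, isotropicWeight B m T (W i) ≤ r * ∑ i ∈ I, isotropicWeight B m S (W i) := by
  set A := univ.filter (fun s => s ∈ B.orthogonal S ∧ s ∉ S) with hA
  have hcard : (A.card : ℝ) =
      2 ^ (2 * n - finrank (ZMod 2) S) - 2 ^ finrank (ZMod 2) S := by
    have hsdiff : A = univ.filter (· ∈ B.orthogonal S) \ univ.filter (· ∈ S) := by
      ext s
      simp [hA]
    have hsub : univ.filter (· ∈ S) ⊆ univ.filter (· ∈ B.orthogonal S) :=
      monotone_filter_right _ fun s _ hs => hiso hs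
    rw [hsdiff, cast_card_sdiff hsub, card_filter_mem_submodule, card_filter_mem_submodule,
      LinearMap.BilinForm.finrank_orthogonal hB, hV]
  have hpos : (0 : ℝ) < A.card := by
    rw [hcard, sub_pos]
    exact pow_lt_pow_right₀ one_lt_two (by omega)
  have hne : A.Nonempty := card_pos.1 (by exact_mod_cast hpos)
  have hsum : ∑ s ∈ A, ∑ i ∈ I, isotropicWeight B m (S ⊔ Submodule.span (ZMod 2) {s}) (W i) ≤
      ∑ s ∈ A, r * ∑ i ∈ I, isotropicWeight B m S (W i) := by
    rw [sum_comm, sum_const, nsmul_eq_mul, hcard]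
    calc _ ≤ ∑ i ∈ I, _ := sum_le_sum fun i hi =>
          sum_isotropicWeight_sup_span_le hB hB'.isRefl hV hS (hW i hi)
      _ ≤ _ := by
          rw [← mul_sum, ← mul_assoc, mul_comm _ r]
          exact mul_le_mul_of_nonneg_right hr
            (sum_nonneg fun i _ => isotropicWeight_nonneg _ _ _)
  obtain ⟨s, hs, hle⟩ := exists_le_of_sum_le hne hsum
  obtain ⟨hsS, hsS'⟩ := (mem_filter.1 hs).2
  refine ⟨_, Submodule.finrank_sup_span_singleton hsS', ?_, hle⟩
  intro x hx y hy
  obtain ⟨a, ha, b, hb, rfl⟩ := Submodule.mem_sup.1 hx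
  obtain ⟨a', ha', b', hb', rfl⟩ := Submodule.mem_sup.1 hy
  obtain ⟨c, rfl⟩ := Submodule.mem_span_singleton.1 hb
  obtain ⟨c', rfl⟩ := Submodule.mem_span_singleton.1 hb'
  have h₁ : B a' a = 0 := hiso ha a' ha'
  have h₂ : B a' s = 0 := hsS a' ha'
  have h₃ : B s a = 0 := hB'.isRefl _ _ (hsS a ha)
  have h₄ : B s s = 0 := hB' s
  simp [h₁, h₂, h₃, h₄]

/-- If `W i` are fewer than `r⁻ᵐ` subspaces of dimension `L`, then some `m`-dimensional isotropic
subspace is orthogonal to none of them. -/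
lemma exists_isotropic_forall_not_le (hB : B.Nondegenerate) (hB' : B.IsAlt) {n m L : ℕ}
    (hmn : m ≤ n) (hV : finrank (ZMod 2) V = 2 * n) {ι : Type*} (I : Finset ι)
    (W : ι → Submodule (ZMod 2) V) (hW : ∀ i ∈ I, finrank (ZMod 2) (W i) = L) {r : ℝ} (hr0 : 0 ≤ r)
    (hr : ∀ j < m, (2 : ℝ) ^ (2 * n - j) / 2 ^ L + 2 ^ (L + m) ≤ r * (2 ^ (2 * n - j) - 2 ^ j))
    (hI : I.card * r ^ m < 1) :
    ∃ S : Submodule (ZMod 2) V, finrank (ZMod 2) S = m ∧ S ≤ B.orthogonal S ∧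
      ∀ i ∈ I, ¬ W i ≤ B.orthogonal S := by
  have key : ∀ j ≤ m, ∃ S : Submodule (ZMod 2) V, finrank (ZMod 2) S = j ∧ S ≤ B.orthogonal S ∧
      ∑ i ∈ I, isotropicWeight B m S (W i) ≤ r ^ j * I.card := by
    intro j
    induction j with
    | zero =>
      intro _
      refine ⟨⊥, finrank_bot _ _, bot_le, ?_⟩
      have h : ∀ i, isotropicWeight B m ⊥ (W i) ≤ 1 := fun i => by
        unfold isotropicWeight
        rw [bot_inf_eq, finrank_bot, zero_mul, pow_zero]
        split_ifs <;> norm_num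
      simpa using sum_le_sum fun i (_ : i ∈ I) => h i
    | succ j ih =>
      intro hj
      obtain ⟨S, rfl, hiso, hsum⟩ := ih (by omega)
      obtain ⟨T, hT, hT', hTsum⟩ := exists_isotropic_sup_span hB hB' hV I W hW
        (by omega : _ < m) (by omega) hiso (hr _ (by omega))
      refine ⟨T, hT, hT', hTsum.trans ?_⟩
      rw [pow_succ', mul_assoc]
      exact mul_le_mul_of_nonneg_left hsum hr0
  obtain ⟨S, hS, hiso, hsum⟩ := key m le_rfl
  refine ⟨S, hS, hiso, fun i hi hle => ?_⟩
  have h₁ : isotropicWeight B m S (W i) = 1 := by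
    simp [isotropicWeight, if_pos hle, hS]
  have h₂ := single_le_sum (f := fun i => isotropicWeight B m S (W i))
    (fun i _ => isotropicWeight_nonneg _ _ _) hi
  simp only [h₁] at h₂
  linarith [mul_comm (I.card : ℝ) (r ^ m)]

end Isotropic

section SymplecticSpace

open Finset

lemma symp_comm {n : ℕ} (x y : (Fin n → ZMod 2) × (Fin n → ZMod 2)) : symp x y = symp y x :=
  add_comm _ _

/-- `symp` as a bilinear form. -/
def sympForm (n : ℕ) : LinearMap.BilinForm (ZMod 2) ((Fin n → ZMod 2) × (Fin n → ZMod 2)) :=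
  LinearMap.mk₂ (ZMod 2) symp
    (fun x y z => by simp only [symp, Prod.fst_add, Prod.snd_add, Pi.add_apply, add_mul, mul_add,
      sum_add_distrib]; ring)
    (fun c x y => by simp only [symp, Prod.smul_fst, Prod.smul_snd, Pi.smul_apply, smul_eq_mul,
      mul_add, mul_sum, mul_left_comm, mul_assoc])
    (fun x y z => by simp only [symp, Prod.fst_add, Prod.snd_add, Pi.add_apply, add_mul, mul_add,
      sum_add_distrib]; ring)
    (fun c x y => by simp only [symp, Prod.smul_fst, Prod.smul_snd, Pi.smul_apply, smul_eq_mul,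
      mul_add, mul_sum, mul_left_comm, mul_assoc])

@[simp]
lemma sympForm_apply {n : ℕ} (x y : (Fin n → ZMod 2) × (Fin n → ZMod 2)) :
    sympForm n x y = symp x y := rfl

lemma sympForm_isAlt (n : ℕ) : (sympForm n).IsAlt := fun x =>
  CharTwo.add_self_eq_zero (∑ i, x.1 i * x.2 i)

lemma sympForm_nondegenerate (n : ℕ) : (sympForm n).Nondegenerate := by
  refine (sympForm_isAlt n).isRefl.nondegenerate_iff_separatingLeft.2 fun x hx => ?_
  ext i
  · simpa [symp, Pi.single_apply] using hx (0, Pi.single i 1)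
  · simpa [symp, Pi.single_apply] using hx (Pi.single i 1, 0)

lemma sum_pow_wt (n : ℕ) (a : ℝ) :
    ∑ x : (Fin n → ZMod 2) × (Fin n → ZMod 2), a ^ wt x = (1 + 3 * a) ^ n := by
  let f : ZMod 2 × ZMod 2 → ℝ := fun c => if ¬(c.1 = 0 ∧ c.2 = 0) then a else 1
  have hf : ∑ c, f c = 1 + 3 * a := by
    rw [Fintype.sum_prod_type]
    change ∑ x : Fin 2, ∑ y : Fin 2, f (x, y) = _
    simp only [Fin.sum_univ_two]
    have h₀ : f ((0 : Fin 2), (0 : Fin 2)) = 1 := if_neg (by decide)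
    have h₁ : f ((0 : Fin 2), (1 : Fin 2)) = a := if_pos (by decide)
    have h₂ : f ((1 : Fin 2), (0 : Fin 2)) = a := if_pos (by decide)
    have h₃ : f ((1 : Fin 2), (1 : Fin 2)) = a := if_pos (by decide)
    rw [h₀, h₁, h₂, h₃]
    ring
  rw [← hf, ← Fintype.card_fin n, Fintype.sum_pow, Fintype.card_fin]
  refine (Fintype.sum_equiv (Equiv.arrowProdEquivProdArrow (Fin n) _ _) _ _ fun c => ?_).symm
  rw [wt, prod_ite, prod_const, prod_const_one, mul_one]
  rfl

lemma card_wt_le {p : ℝ} (hp0 : 0 < p) (hp1 : p < 1 / 2) (n : ℕ) :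
    ((univ.filter fun x : (Fin n → ZMod 2) × (Fin n → ZMod 2) => wt x ≤ ⌊p * n⌋₊).card : ℝ) ≤
      2 ^ ((H p + p * Real.logb 2 3) * n) := by
  set A := univ.filter fun x : (Fin n → ZMod 2) × (Fin n → ZMod 2) => wt x ≤ ⌊p * n⌋₊ with hA
  have hq : 0 < 1 - p := by linarith
  set a := p / (3 * (1 - p)) with ha
  have ha0 : 0 < a := by positivity
  have ha1 : a ≤ 1 := by
    rw [ha, div_le_one (by positivity)]
    linarith
  have h₁ : A.card * a ^ (p * n) ≤ (1 - p)⁻¹ ^ n := by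
    calc A.card * a ^ (p * n) = ∑ x ∈ A, a ^ (p * n) := by rw [sum_const, nsmul_eq_mul]
      _ ≤ ∑ x ∈ A, a ^ wt x := by
          refine sum_le_sum fun x hx => ?_
          rw [← Real.rpow_natCast]
          refine Real.rpow_le_rpow_of_exponent_ge ha0 ha1 ?_
          exact (Nat.le_floor_iff (by positivity)).1 (mem_filter.1 hx).2
      _ ≤ ∑ x, a ^ wt x :=
          sum_le_sum_of_subset_of_nonneg (subset_univ _) fun x _ _ => by positivity
      _ = (1 - p)⁻¹ ^ n := by
          rw [sum_pow_wt]
          congr 1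
          rw [ha]
          field_simp
          ring
  have h₂ : (1 - p)⁻¹ ^ n = (2 : ℝ) ^ ((H p + p * Real.logb 2 3) * n) * a ^ (p * n) := by
    rw [← Real.rpow_natCast]
    refine Real.logb_injOn_pos one_lt_two (Set.mem_Ioi.2 (by positivity))
      (Set.mem_Ioi.2 (by positivity)) ?_
    rw [Real.logb_rpow_eq_mul_logb_of_pos (by positivity), Real.logb_mul (by positivity)
      (by positivity), Real.logb_rpow (by norm_num) (by norm_num),
      Real.logb_rpow_eq_mul_logb_of_pos ha0, Real.logb_inv, ha, Real.logb_div (by positivity)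
      (by positivity), Real.logb_mul (by norm_num) (by positivity), H]
    ring
  rw [h₂] at h₁
  exact le_of_mul_le_mul_right h₁ (by positivity)

end SymplecticSpace

section Differences

lemma LinearIndependent.succ_sub_zero {K V : Type*} [Ring K] [AddCommGroup V]
    [Module K V] {L : ℕ} {E : Fin (L + 1) → V} (hE : LinearIndependent K E) :
    LinearIndependent K fun i : Fin L => E i.succ - E 0 := by
  rw [Fintype.linearIndependent_iff] at hE ⊢
  intro g hg i
  have h := hE (Fin.cons (-∑ i, g i) g) (by
    simp only [smul_sub, Finset.sum_sub_distrib, ← Finset.sum_smul] at hg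
    rw [Fin.sum_univ_succ, Fin.cons_zero, neg_smul, neg_add_eq_sub, ← hg]
    simp) i.succ
  simpa using h

end Differences

section Parameters

open Filter

lemma eventually_floor_ratio_le {R c : ℝ} (hR : 0 < R) (hc : 1 < c) (L : ℕ) :
    ∀ᶠ n : ℕ in atTop, ∀ j < n - ⌊R * (n : ℝ)⌋₊,
      (2 : ℝ) ^ (2 * n - j) / 2 ^ L + 2 ^ (L + (n - ⌊R * (n : ℝ)⌋₊)) ≤
        c / 2 ^ L * (2 ^ (2 * n - j) - 2 ^ j) := by
  have hlim : Tendsto (fun n : ℕ => (1 / 4 : ℝ) ^ ⌊R * (n : ℝ)⌋₊) atTop (nhds 0) :=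
    (tendsto_pow_atTop_nhds_zero_of_lt_one (by norm_num) (by norm_num)).comp
      (tendsto_nat_floor_atTop.comp (tendsto_natCast_atTop_atTop.const_mul_atTop hR))
  have hpos : 0 < (c - 1) / (4 ^ L + c) := div_pos (by linarith) (by positivity)
  filter_upwards [hlim.eventually_le_const hpos] with n hn j hj
  set k := ⌊R * (n : ℝ)⌋₊
  rw [le_div_iff₀ (by positivity)] at hn
  set x : ℝ := (1 / 4) ^ k with hx
  have hx4 : x * 2 ^ (2 * k) = 1 := by
    rw [hx, pow_mul, ← mul_pow]
    norm_num
  have h₁ : (2 : ℝ) ^ j ≤ 2 ^ (2 * n - j) * x := by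
    have h : (2 : ℝ) ^ (j + 2 * k) ≤ 2 ^ (2 * n - j) := pow_le_pow_right₀ one_le_two (by omega)
    calc (2 : ℝ) ^ j = 2 ^ (j + 2 * k) * x := by rw [pow_add, mul_assoc, mul_comm _ x, hx4, mul_one]
      _ ≤ _ := by gcongr
  have h₂ : (2 : ℝ) ^ (L + (n - k)) ≤ 2 ^ (2 * n - j) / 2 ^ L * (4 ^ L * x) := by
    have h : (2 : ℝ) ^ (n - k + 2 * k) ≤ 2 ^ (2 * n - j) := pow_le_pow_right₀ one_le_two (by omega)
    calc (2 : ℝ) ^ (L + (n - k)) = 2 ^ L * (2 ^ (n - k + 2 * k) * x) := by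
          rw [pow_add _ (n - k), mul_assoc, mul_comm _ x, hx4, mul_one, pow_add]
      _ ≤ 2 ^ L * (2 ^ (2 * n - j) * x) := by gcongr
      _ = _ := by
          rw [show (4 : ℝ) = 2 * 2 by norm_num, mul_pow]
          field_simp
  calc (2 : ℝ) ^ (2 * n - j) / 2 ^ L + 2 ^ (L + (n - k))
      ≤ 2 ^ (2 * n - j) / 2 ^ L * (1 + 4 ^ L * x) := by rw [mul_add, mul_one]; gcongr
    _ ≤ 2 ^ (2 * n - j) / 2 ^ L * (c * (1 - x)) := by
        gcongr
        linarith
    _ = c / 2 ^ L * (2 ^ (2 * n - j) - 2 ^ (2 * n - j) * x) := by ring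
    _ ≤ _ := by gcongr

end Parameters

theorem stmt_0 (p R : ℝ) (hp0 : 0 < p) (hp1 : p < 1 / 2) (hR : 0 < R)
    (L : ℕ) (hL : 0 < L)
    (hrate : R < 1 - (1 + 1 / (L : ℝ)) * (H p + p * Real.logb 2 3)) :
    ∃ N : ℕ, ∀ n ≥ N,
      ∃ S : Submodule (ZMod 2) ((Fin n → ZMod 2) × (Fin n → ZMod 2)),
        Module.finrank (ZMod 2) S = n - ⌊R * (n : ℝ)⌋₊ ∧
        (∀ x ∈ S, ∀ y ∈ S, symp x y = 0) ∧
        ¬∃ E : Fin (L + 1) → (Fin n → ZMod 2) × (Fin n → ZMod 2),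
            LinearIndependent (ZMod 2) E ∧
            (∀ i, wt (E i) ≤ ⌊p * (n : ℝ)⌋₊ ∧ E i ∉ S) ∧
            (∀ i j, ∀ s ∈ S, symp (E i + E j) s = 0) := by
  classical
  set h := H p + p * Real.logb 2 3
  have hL' : (0 : ℝ) < L := by exact_mod_cast hL
  set γ := L * (1 - R) - (L + 1) * h with hγ
  have hγ0 : 0 < γ := by
    have h₁ := mul_lt_mul_of_pos_left hrate hL'
    have h₂ : L * (1 - (1 + 1 / (L : ℝ)) * h) = L - (L + 1) * h := by
      field_simp
    rw [h₂] at h₁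
    rw [hγ]
    linarith
  have hc : (1 : ℝ) < 2 ^ (γ / 2) := Real.one_lt_rpow one_lt_two (by positivity)
  obtain ⟨N, hN⟩ := Filter.eventually_atTop.1 (eventually_floor_ratio_le hR hc L)
  refine ⟨max N 1, fun n hn => ?_⟩
  set m := n - ⌊R * (n : ℝ)⌋₊
  have hn0 : (0 : ℝ) < n := by exact_mod_cast (le_max_right N 1).trans hn
  have hmn : (m : ℝ) ≤ n := by exact_mod_cast Nat.sub_le _ _
  have hmR : (1 - R) * n ≤ m := by
    have h₁ : (n : ℝ) ≤ m + ⌊R * (n : ℝ)⌋₊ := by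
      exact_mod_cast (by omega : n ≤ m + ⌊R * (n : ℝ)⌋₊)
    have h₂ : (⌊R * (n : ℝ)⌋₊ : ℝ) ≤ R * n := Nat.floor_le (by positivity)
    linarith
  let A := Finset.univ.filter fun x : (Fin n → ZMod 2) × (Fin n → ZMod 2) => wt x ≤ ⌊p * n⌋₊
  let I := (Fintype.piFinset fun _ : Fin (L + 1) => A).filter fun E => LinearIndependent (ZMod 2) E
  let W : (Fin (L + 1) → (Fin n → ZMod 2) × (Fin n → ZMod 2)) → Submodule (ZMod 2) _ :=
    fun E => Submodule.span (ZMod 2) (Set.range fun i : Fin L => E i.succ - E 0)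
  have hW : ∀ E ∈ I, Module.finrank (ZMod 2) (W E) = L := fun E hE => by
    rw [finrank_span_eq_card (Finset.mem_filter.1 hE).2.succ_sub_zero, Fintype.card_fin]
  have hI : (I.card : ℝ) * (2 ^ (γ / 2) / 2 ^ L) ^ m < 1 := by
    have hIA : (I.card : ℝ) ≤ (A.card : ℝ) ^ (L + 1) := by
      have := Finset.card_filter_le (Fintype.piFinset fun _ : Fin (L + 1) => A)
        fun E => LinearIndependent (ZMod 2) E
      rw [Fintype.card_piFinset_const] at this
      exact_mod_cast this
    calc (I.card : ℝ) * (2 ^ (γ / 2) / 2 ^ L) ^ m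
        ≤ (2 ^ (h * n)) ^ (L + 1) * (2 ^ (γ / 2) / 2 ^ L) ^ m := by
          gcongr
          exact hIA.trans (by gcongr; exact card_wt_le hp0 hp1 n)
      _ = 2 ^ (h * n * (L + 1) + (γ / 2 - L) * m) := by
          rw [Real.rpow_add two_pos, Real.rpow_mul zero_le_two (h * n),
            Real.rpow_mul zero_le_two (γ / 2 - L), Real.rpow_sub two_pos, Real.rpow_natCast,
            Real.rpow_natCast]
          norm_cast
      _ < 1 := Real.rpow_lt_one_of_one_lt_of_neg one_lt_two (by
          have h₁ := mul_le_mul_of_nonneg_left hmn hγ0.le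
          have h₂ := mul_le_mul_of_nonneg_left hmR hL'.le
          have h₃ := mul_pos hγ0 hn0
          have h₄ : γ * n = L * ((1 - R) * n) - h * n * (L + 1) := by rw [hγ]; ring
          linarith)
  have hV : Module.finrank (ZMod 2) ((Fin n → ZMod 2) × (Fin n → ZMod 2)) = 2 * n := by
    simp [two_mul]
  obtain ⟨S, hS, hiso, hSW⟩ := exists_isotropic_forall_not_le (sympForm_nondegenerate n)
    (sympForm_isAlt n) (Nat.sub_le _ _) hV I W hW (by positivity)
    (hN n ((le_max_left _ _).trans hn)) hI
  refine ⟨S, hS, fun x hx y hy => hiso hy x hx, ?_⟩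
  rintro ⟨E, hE, hwt, hsymp⟩
  refine hSW E (Finset.mem_filter.2 ⟨Fintype.mem_piFinset.2 fun i => Finset.mem_filter.2
    ⟨Finset.mem_univ _, (hwt i).1⟩, hE⟩) (Submodule.span_le.2 ?_)
  rintro _ ⟨i, rfl⟩ s hs
  change symp s (E i.succ - E 0) = 0
  rw [symp_comm, ZModModule.sub_eq_add]
  exact hsymp _ _ s hs
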